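/- Let C be a linear code of length n over a finite commutative principal ideal ring R and let λ be a positive integer. Let A be the (t+1)×(t+1) 0–1 matrix with A_{ij} = 1 iff a_iR ⊆ a_jR, D = diag(|a_0R|, …, |a_tR|), and Q the 0–1 matrix with Q_{ij} = 1 iff a_jR ⊆ (a_iR)⊥ = {r ∈ R : a_i r = 0}. Then swe^[λ]_{C⊥}(x) = (1/|C|^λ) · swe^[λ]_C(Q D^λ A^{−1} x), as an identity of polynomials in x_0, …, x_t. -/

import Mathlib

noncomputable section
open scoped BigOperators

/-- The dual of a linear code `C ⊆ Rⁿ` with respect to the standard inner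
product `u·v = ∑ ℓ, u ℓ * v ℓ`. -/
def dualCode {R : Type*} [CommRing R] {n : ℕ} (C : Submodule R (Fin n → R)) :
    Submodule R (Fin n → R) where
  carrier := {v | ∀ u ∈ C, ∑ ℓ, u ℓ * v ℓ = 0}
  add_mem' := by
    intro v w hv hw u hu
    simp only [Set.mem_setOf_eq] at *
    have h1 := hv u hu
    have h2 := hw u hu
    simp only [Pi.add_apply, mul_add, Finset.sum_add_distrib, h1, h2, add_zero]
  zero_mem' := by
    intro u hu
    simp
  smul_mem' := by
    intro c v hv u hu
    simp only [Set.mem_setOf_eq] at *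
    have h := hv u hu
    have : ∑ ℓ, u ℓ * (c • v) ℓ = c * ∑ ℓ, u ℓ * v ℓ := by
      rw [Finset.mul_sum]
      exact Finset.sum_congr rfl fun ℓ _ => by
        simp only [Pi.smul_apply, smul_eq_mul]; ring
    rw [this, h, mul_zero]

/-- A finite commutative ring is Frobenius iff `|C|·|C⊥| = |R|ⁿ` for every
linear code `C` of every length `n` over `R`. -/
def IsFrobeniusRing (R : Type*) [CommRing R] [Fintype R] : Prop :=
  ∀ (n : ℕ) (C : Submodule R (Fin n → R)),
    Nat.card C * Nat.card (dualCode C) = Fintype.card R ^ n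

open MvPolynomial Classical

/-- The `λ`-tuple symmetrized weight enumerator
`swe^[λ]_C(x₀, …, x_t) = ∑_{(c₁,…,c_λ) ∈ C^λ} ∏ᵢ xᵢ^{|S^[λ]ᵢ(c₁,…,c_λ)|}`,
where `S^[λ]_i(c₁,…,c_λ) = {ℓ : c_{1ℓ}R + ⋯ + c_{λℓ}R = a_i R}`. -/
def sweL {R : Type*} [CommRing R] [Fintype R] {t n : ℕ} (a : Fin (t + 1) → R)
    (C : Submodule R (Fin n → R)) (lam : ℕ) : MvPolynomial (Fin (t + 1)) ℚ :=
  haveI : Fintype C := Fintype.ofFinite C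
  ∑ cs : Fin lam → C, ∏ i,
    X i ^ (Nat.card {ℓ : Fin n //
      Ideal.span (Set.range fun k => (cs k : Fin n → R) ℓ) = Ideal.span {a i}})

section Counting

variable {R M N : Type*} [CommRing R] [AddCommGroup M] [Module R M] [AddCommGroup N] [Module R N]

theorem Submodule.card_eq_card_inf_ker_mul_card_map [Finite M] (S : Submodule R M)
    (f : M →ₗ[R] N) :
    Nat.card S = Nat.card (S ⊓ LinearMap.ker f : Submodule R M) * Nat.card (S.map f) := by
  have h := Submodule.card_eq_card_quotient_mul_card (LinearMap.ker (f.domRestrict S))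
  have e₁ := Nat.card_congr (f.domRestrict S).quotKerEquivRange.toEquiv
  have hr : LinearMap.range (f.domRestrict S) = S.map f := by
    rw [LinearMap.domRestrict, LinearMap.range_comp, Submodule.range_subtype]
  have hk : (LinearMap.ker (f.domRestrict S)).map S.subtype = S ⊓ LinearMap.ker f := by
    rw [LinearMap.domRestrict, LinearMap.ker_comp, Submodule.map_comap_subtype]
  have e₂ := Nat.card_congr
    (Submodule.equivMapOfInjective S.subtype S.injective_subtype
      (LinearMap.ker (f.domRestrict S))).toEquiv
  rw [h, e₁, e₂, hr, hk, mul_comm]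

theorem Submodule.card_map_of_injective (S : Submodule R M) (f : M →ₗ[R] N)
    (hf : Function.Injective f) : Nat.card (S.map f) = Nat.card S :=
  (Nat.card_congr (Submodule.equivMapOfInjective f hf S).toEquiv).symm

theorem Submodule.card_sup_mul_card_inf [Finite M] (S T : Submodule R M) :
    Nat.card (S ⊔ T : Submodule R M) * Nat.card (S ⊓ T : Submodule R M) =
      Nat.card S * Nat.card T := by
  have h₁ := S.card_eq_card_inf_ker_mul_card_map T.mkQ
  have h₂ := (S ⊔ T).card_eq_card_inf_ker_mul_card_map T.mkQ
  rw [Submodule.ker_mkQ] at h₁ h₂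
  rw [inf_eq_right.2 le_sup_right, Submodule.map_sup, Submodule.mkQ_map_self, sup_bot_eq] at h₂
  rw [h₁, h₂]
  ring

end Counting

section Annihilator

variable {R : Type*} [CommRing R] [Finite R]

theorem Ideal.card_annihilator_mul_card_of_isPrincipal (I : Ideal R) [I.IsPrincipal] :
    Nat.card (Submodule.annihilator I) * Nat.card I = Nat.card R := by
  obtain ⟨a, rfl⟩ := Submodule.IsPrincipal.principal I
  have h := (⊤ : Submodule R R).card_eq_card_inf_ker_mul_card_map (LinearMap.toSpanSingleton R R a)
  rw [top_inf_eq, ← LinearMap.range_eq_map, LinearMap.range_toSpanSingleton] at h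
  rw [Nat.card_congr (Equiv.Set.univ R).symm]
  refine Eq.trans ?_ h.symm
  congr 3
  ext r
  simp

theorem Ideal.annihilator_annihilator_of_isPrincipalIdealRing [IsPrincipalIdealRing R]
    (I : Ideal R) : Submodule.annihilator (Submodule.annihilator I) = I := by
  have h₁ := I.card_annihilator_mul_card_of_isPrincipal
  have h₂ := Ideal.card_annihilator_mul_card_of_isPrincipal (Submodule.annihilator I)
  have hle : I ≤ Submodule.annihilator (Submodule.annihilator I) := fun x hx =>
    Submodule.mem_annihilator.2 fun r hr => by
      rw [smul_eq_mul, mul_comm]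
      exact Submodule.mem_annihilator.1 hr x hx
  have hcard : Nat.card (Submodule.annihilator (Submodule.annihilator I)) = Nat.card I :=
    Nat.eq_of_mul_eq_mul_right (Nat.card_pos (α := Submodule.annihilator I))
      (h₂.trans (h₁.symm.trans (mul_comm _ _)))
  exact (SetLike.coe_injective
    (Set.eq_of_subset_of_ncard_le hle (le_of_eq hcard) (Set.toFinite _))).symm

end Annihilator

section Dual

variable {R : Type*} [CommRing R] {n : ℕ}

theorem mem_dualCode {C : Submodule R (Fin n → R)} {v : Fin n → R} :
    v ∈ dualCode C ↔ ∀ u ∈ C, ∑ ℓ, u ℓ * v ℓ = 0 :=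
  Iff.rfl

theorem dualCode_sup (C E : Submodule R (Fin n → R)) :
    dualCode (C ⊔ E) = dualCode C ⊓ dualCode E := by
  ext v
  simp only [Submodule.mem_inf, mem_dualCode]
  refine ⟨fun h => ⟨fun u hu => h u (le_sup_left (a := C) hu),
    fun u hu => h u (le_sup_right (b := E) hu)⟩, fun h u hu => ?_⟩
  obtain ⟨c, hc, e, he, rfl⟩ := Submodule.mem_sup.1 hu
  simp [add_mul, Finset.sum_add_distrib, h.1 c hc, h.2 e he]

theorem dualCode_pi (I : Fin n → Ideal R) :
    dualCode (Submodule.pi Set.univ I) =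
      Submodule.pi Set.univ fun ℓ => Submodule.annihilator (I ℓ) := by
  ext v
  simp only [mem_dualCode, Submodule.mem_pi, Set.mem_univ, forall_const,
    Submodule.mem_annihilator, smul_eq_mul]
  refine ⟨fun h ℓ r hr => ?_, fun h u hu => Finset.sum_eq_zero fun ℓ _ => ?_⟩
  · have := h (Pi.single ℓ r) fun m => by
      obtain rfl | hm := eq_or_ne m ℓ
      · simpa using hr
      · simp [hm]
    rw [Finset.sum_eq_single ℓ (fun m _ hm => by simp [hm]) (by simp)] at this
    simpa [mul_comm] using this
  · rw [mul_comm]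
    exact h ℓ _ (hu ℓ)

/-- Prepending a zero coordinate, as a linear map. -/
def consZero (R : Type*) [CommRing R] (n : ℕ) : (Fin n → R) →ₗ[R] (Fin (n + 1) → R) where
  toFun w := Fin.cons 0 w
  map_add' v w := by
    ext ℓ
    refine Fin.cases ?_ (fun m => ?_) ℓ <;> simp
  map_smul' r w := by
    ext ℓ
    refine Fin.cases ?_ (fun m => ?_) ℓ <;> simp

theorem map_consZero_comap (C : Submodule R (Fin (n + 1) → R)) :
    (C.comap (consZero R n)).map (consZero R n) = C ⊓ LinearMap.ker (LinearMap.proj 0) := by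
  ext u
  simp only [Submodule.mem_map, Submodule.mem_comap, Submodule.mem_inf, LinearMap.mem_ker,
    LinearMap.proj_apply]
  constructor
  · rintro ⟨w, hw, rfl⟩
    exact ⟨hw, rfl⟩
  · rintro ⟨hu, h0⟩
    have : consZero R n (Fin.tail u) = u := by
      change Fin.cons 0 (Fin.tail u) = u
      rw [← h0, Fin.cons_self_tail]
    exact ⟨Fin.tail u, by rwa [this], this⟩

theorem map_tail_dualCode [Finite R] [IsPrincipalIdealRing R]
    (C : Submodule R (Fin (n + 1) → R)) :
    (dualCode C).map (LinearMap.funLeft R R Fin.succ) = dualCode (C.comap (consZero R n)) := by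
  ext v
  simp only [Submodule.mem_map]
  constructor
  · rintro ⟨v, hv, rfl⟩ w hw
    simpa [consZero, Fin.sum_univ_succ, LinearMap.funLeft_apply] using hv _ hw
  · intro hv
    set I : Ideal R := C.map (LinearMap.proj 0) with hI
    obtain ⟨a, ha⟩ := Submodule.IsPrincipal.principal I
    obtain ⟨u₀, hu₀, hu₀a⟩ : ∃ u ∈ C, u 0 = a := by
      have : a ∈ I := ha ▸ Submodule.mem_span_singleton_self a
      simpa [hI] using this
    have key : ∀ u ∈ C, u 0 = 0 → ∑ ℓ, u (Fin.succ ℓ) * v ℓ = 0 := fun u hu h0 => by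
      refine hv (Fin.tail u) ?_
      change Fin.cons 0 (Fin.tail u) ∈ C
      rwa [← h0, Fin.cons_self_tail]
    have hb : -∑ ℓ, u₀ (Fin.succ ℓ) * v ℓ ∈ I := by
      rw [← I.annihilator_annihilator_of_isPrincipalIdealRing]
      refine Submodule.mem_annihilator.2 fun r hr => ?_
      rw [ha, Submodule.mem_annihilator_span_singleton, smul_eq_mul] at hr
      have := key (r • u₀) (C.smul_mem r hu₀) (by simp [hu₀a, hr])
      simp only [Pi.smul_apply, smul_eq_mul, mul_assoc, ← Finset.mul_sum] at this
      rw [smul_eq_mul, neg_mul, mul_comm, this, neg_zero]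
    rw [ha, Submodule.mem_span_singleton] at hb
    obtain ⟨r, hr⟩ := hb
    refine ⟨Fin.cons r v, fun u hu => ?_, by ext; simp [LinearMap.funLeft_apply]⟩
    have hu0 : u 0 ∈ I := Submodule.mem_map_of_mem (f := LinearMap.proj 0) hu
    rw [ha, Submodule.mem_span_singleton] at hu0
    obtain ⟨s, hs⟩ := hu0
    have := key (u - s • u₀) (C.sub_mem hu (C.smul_mem s hu₀)) (by simp [hu₀a, ← hs])
    simp only [Pi.sub_apply, Pi.smul_apply, smul_eq_mul, sub_mul, mul_assoc,
      Finset.sum_sub_distrib, ← Finset.mul_sum] at this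
    simp only [Fin.sum_univ_succ, Fin.cons_zero, Fin.cons_succ, ← hs]
    simp only [smul_eq_mul] at hr ⊢
    linear_combination this + s * hr

theorem dualCode_inf_ker_tail (C : Submodule R (Fin (n + 1) → R)) :
    dualCode C ⊓ LinearMap.ker (LinearMap.funLeft R R Fin.succ) =
      Submodule.map (LinearMap.single R (fun _ : Fin (n + 1) => R) 0)
        (Submodule.annihilator (C.map (LinearMap.proj 0 : (Fin (n + 1) → R) →ₗ[R] R))) := by
  ext v
  simp only [Submodule.mem_map, Submodule.mem_inf, LinearMap.mem_ker, Submodule.mem_annihilator]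
  constructor
  · rintro ⟨hv, h0⟩
    have h0' : ∀ ℓ : Fin n, v ℓ.succ = 0 := fun ℓ => congrFun h0 ℓ
    refine ⟨v 0, ?_, ?_⟩
    · rintro _ ⟨u, hu, rfl⟩
      simpa [Fin.sum_univ_succ, h0', mul_comm] using hv u hu
    · ext ℓ
      refine Fin.cases ?_ (fun m => ?_) ℓ <;> simp [h0']
  · rintro ⟨r, hr, rfl⟩
    refine ⟨fun u hu => ?_, by ext ℓ; simp [LinearMap.funLeft_apply]⟩
    simpa [Fin.sum_univ_succ, mul_comm] using hr _ ⟨u, hu, rfl⟩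

/-- Finite commutative principal ideal rings are Frobenius. -/
theorem isFrobeniusRing_of_isPrincipalIdealRing (R : Type*) [CommRing R] [Fintype R]
    [IsPrincipalIdealRing R] : IsFrobeniusRing R := by
  intro n
  induction n with
  | zero =>
    intro C
    rw [Nat.card_unique, Nat.card_unique, pow_zero, mul_one]
  | succ n ih =>
    intro C
    have hinj : Function.Injective (consZero R n) :=
      Fin.cons_right_injective (α := fun _ => R) 0
    have hsingle : Function.Injective (LinearMap.single R (fun _ : Fin (n + 1) => R) 0) :=
      Pi.single_injective (M := fun _ : Fin (n + 1) => R) 0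
    rw [C.card_eq_card_inf_ker_mul_card_map (LinearMap.proj 0), ← map_consZero_comap,
      Submodule.card_map_of_injective _ _ hinj,
      (dualCode C).card_eq_card_inf_ker_mul_card_map (LinearMap.funLeft R R Fin.succ),
      map_tail_dualCode, dualCode_inf_ker_tail,
      Submodule.card_map_of_injective _ _ hsingle, pow_succ,
      ← ih (C.comap (consZero R n)), Fintype.card_eq_nat_card,
      ← Ideal.card_annihilator_mul_card_of_isPrincipal (C.map (LinearMap.proj 0))]
    ring

theorem IsFrobeniusRing.dualCode_dualCode [Fintype R] (hR : IsFrobeniusRing R)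
    (C : Submodule R (Fin n → R)) : dualCode (dualCode C) = C := by
  have hle : C ≤ dualCode (dualCode C) := fun u hu v hv => by
    simpa only [mul_comm] using hv u hu
  have hcard : Nat.card (dualCode (dualCode C)) = Nat.card C :=
    Nat.eq_of_mul_eq_mul_left (Nat.card_pos (α := dualCode C))
      ((hR n _).trans ((hR n C).symm.trans (mul_comm _ _)))
  exact (SetLike.coe_injective
    (Set.eq_of_subset_of_ncard_le hle (le_of_eq hcard) (Set.toFinite _))).symm

theorem IsFrobeniusRing.card_mul_card_dualCode_inf [Fintype R] (hR : IsFrobeniusRing R)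
    (C E : Submodule R (Fin n → R)) :
    Nat.card C * Nat.card (dualCode C ⊓ E : Submodule R (Fin n → R)) =
      Nat.card E * Nat.card (C ⊓ dualCode E : Submodule R (Fin n → R)) := by
  have h₁ := (hR n (dualCode C ⊔ E)).trans (hR n C).symm
  rw [dualCode_sup, hR.dualCode_dualCode] at h₁
  have h₂ := (dualCode C).card_sup_mul_card_inf E
  refine Nat.eq_of_mul_eq_mul_left (Nat.card_pos (α := dualCode C)) ?_
  calc _ = Nat.card (dualCode C ⊓ E : Submodule R (Fin n → R)) *
        (Nat.card C * Nat.card (dualCode C)) := by ring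
    _ = (Nat.card (dualCode C ⊔ E : Submodule R (Fin n → R)) *
        Nat.card (dualCode C ⊓ E : Submodule R (Fin n → R))) *
        Nat.card (C ⊓ dualCode E : Submodule R (Fin n → R)) := by rw [← h₁]; ring
    _ = _ := by rw [h₂]; ring

theorem card_submodule_pi (I : Fin n → Ideal R) :
    Nat.card (Submodule.pi Set.univ I) = ∏ ℓ, Nat.card (I ℓ) := by
  rw [← Nat.card_pi]
  exact Nat.card_congr
    { toFun := fun v ℓ => ⟨v.1 ℓ, v.2 ℓ (Set.mem_univ ℓ)⟩
      invFun := fun v => ⟨fun ℓ => v ℓ, fun ℓ _ => (v ℓ).2⟩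
      left_inv := fun _ => rfl
      right_inv := fun _ => rfl }

end Dual

section Enumerator

variable {R : Type*} [CommRing R] {t n : ℕ} {a : Fin (t + 1) → R}

theorem prod_pow_card_span_eq [IsPrincipalIdealRing R] {S : Type*} [CommSemiring S]
    (hrep : ∀ r : R, ∃ i, Ideal.span {r} = Ideal.span {a i})
    (hinj : ∀ i j, Ideal.span {a i} = Ideal.span {a j} → i = j)
    {lam : ℕ} (c : Fin lam → Fin n → R) (M : Fin (t + 1) → Ideal R)
    (g w : Fin (t + 1) → S) (hg : ∀ i, g i = ∑ j, if a i ∈ M j then w j else 0) :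
    ∏ i, g i ^ (Nat.card {ℓ : Fin n //
        Ideal.span (Set.range fun k => c k ℓ) = Ideal.span {a i}}) =
      ∏ ℓ, ∑ j, if ∀ k, c k ℓ ∈ M j then w j else 0 := by
  have hidx : ∀ ℓ, ∃ i, Ideal.span (Set.range fun k => c k ℓ) = Ideal.span {a i} := fun ℓ => by
    obtain ⟨r, hr⟩ := Submodule.IsPrincipal.principal (Ideal.span (Set.range fun k => c k ℓ))
    obtain ⟨i, hi⟩ := hrep r
    exact ⟨i, hr.trans hi⟩
  choose idx hidx using hidx
  have hiff : ∀ ℓ i, Ideal.span (Set.range fun k => c k ℓ) = Ideal.span {a i} ↔ idx ℓ = i :=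
    fun ℓ i => ⟨fun h => hinj _ _ ((hidx ℓ).symm.trans h), fun h => h ▸ hidx ℓ⟩
  have hprod : ∀ ℓ, (∑ j, if ∀ k, c k ℓ ∈ M j then w j else 0) = g (idx ℓ) := fun ℓ => by
    rw [hg]
    refine Finset.sum_congr rfl fun j _ => ?_
    have : (∀ k, c k ℓ ∈ M j) ↔ a (idx ℓ) ∈ M j := by
      rw [← Ideal.span_singleton_le_iff_mem, ← hidx, Ideal.span_le, Set.range_subset_iff]
      rfl
    simp only [this]
  simp only [hiff, hprod, Nat.card_eq_fintype_card, Fintype.card_subtype]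
  rw [← Finset.prod_fiberwise' Finset.univ idx g]
  simp

theorem sum_prod_pow_card_span_eq [Fintype R] [IsPrincipalIdealRing R] {S : Type*}
    [CommSemiring S]
    (hrep : ∀ r : R, ∃ i, Ideal.span {r} = Ideal.span {a i})
    (hinj : ∀ i j, Ideal.span {a i} = Ideal.span {a j} → i = j)
    (C : Submodule R (Fin n → R)) [Fintype C] (lam : ℕ) (M : Fin (t + 1) → Ideal R)
    (g w : Fin (t + 1) → S) (hg : ∀ i, g i = ∑ j, if a i ∈ M j then w j else 0) :
    ∑ c : Fin lam → C, ∏ i, g i ^ (Nat.card {ℓ : Fin n //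
        Ideal.span (Set.range fun k => (c k : Fin n → R) ℓ) = Ideal.span {a i}}) =
      ∑ J : Fin n → Fin (t + 1), (∏ ℓ, w (J ℓ)) *
        (Nat.card (C ⊓ Submodule.pi Set.univ fun ℓ => M (J ℓ) : Submodule R (Fin n → R)) : S)
          ^ lam := by
  simp only [fun c : Fin lam → C =>
    prod_pow_card_span_eq hrep hinj (fun k => (c k : Fin n → R)) M g w hg,
    Finset.prod_univ_sum, Fintype.piFinset_univ]
  rw [Finset.sum_comm]
  refine Finset.sum_congr rfl fun J _ => ?_
  have hterm : ∀ c : Fin lam → C,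
      (∏ ℓ, if ∀ k, (c k : Fin n → R) ℓ ∈ M (J ℓ) then w (J ℓ) else 0) =
        (∏ ℓ, w (J ℓ)) * ∏ k, if (c k : Fin n → R) ∈ Submodule.pi Set.univ fun ℓ => M (J ℓ)
          then 1 else 0 := fun c => by
    have hiff : (∀ k, (c k : Fin n → R) ∈ Submodule.pi Set.univ fun ℓ => M (J ℓ)) ↔
        ∀ ℓ k, (c k : Fin n → R) ℓ ∈ M (J ℓ) := by
      simp only [Submodule.mem_pi, Set.mem_univ, forall_const]
      exact forall_comm
    rw [Fintype.prod_ite_zero, Fintype.prod_ite_zero, Finset.prod_const_one, mul_ite, mul_one,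
      mul_zero]
    by_cases h : ∀ ℓ k, (c k : Fin n → R) ℓ ∈ M (J ℓ)
    · exact (if_pos h).trans (if_pos (hiff.2 h)).symm
    · exact (if_neg h).trans (if_neg (mt hiff.1 h)).symm
  simp only [hterm, ← Finset.mul_sum]
  congr 1
  have := (Finset.prod_univ_sum (fun _ : Fin lam => (Finset.univ : Finset C))
    (fun _ (c : C) => if (c : Fin n → R) ∈ Submodule.pi Set.univ fun ℓ => M (J ℓ)
      then (1 : S) else 0)).symm
  rw [Fintype.piFinset_univ] at this
  rw [this, Finset.prod_const, Finset.card_univ, Fintype.card_fin, Finset.sum_boole]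
  congr 2
  rw [← Fintype.card_subtype, ← Nat.card_eq_fintype_card]
  exact Nat.card_congr (Equiv.subtypeSubtypeEquivSubtypeInter (· ∈ C) _)

theorem isUnit_det_of_span_le
    (hinj : ∀ i j, Ideal.span {a i} = Ideal.span {a j} → i = j)
    (A : Matrix (Fin (t + 1)) (Fin (t + 1)) ℚ)
    (hA : ∀ i j, A i j = if Ideal.span {a i} ≤ Ideal.span {a j} then 1 else 0) :
    IsUnit A.det := by
  rw [← Matrix.isUnit_iff_isUnit_det, ← Matrix.mulVec_injective_iff_isUnit]
  refine (injective_iff_map_eq_zero A.mulVecLin).2 fun y hy => ?_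
  by_contra hne
  obtain ⟨i, hi⟩ := Function.ne_iff.1 hne
  obtain ⟨j, hj, hmax⟩ := (Finset.univ.filter fun j => y j ≠ 0).exists_maximalFor
    (fun j => Ideal.span {a j}) ⟨i, by simpa using hi⟩
  have hsum := congrFun hy j
  rw [Matrix.mulVecLin_apply, Matrix.mulVec, dotProduct,
    Finset.sum_eq_single j (fun m _ hm => ?_) (by simp)] at hsum
  · simp [hA] at hsum
    simp [hsum] at hj
  · rw [hA]
    split_ifs with hle
    · by_contra h0
      exact hm (hinj _ _ (le_antisymm (hmax (by simpa using h0) hle) hle))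
    · simp

end Enumerator

/-- over a finite commutative principal ideal ring,
`swe^[λ]_{C⊥}(x) = (1/|C|^λ) · swe^[λ]_C(Q D^λ A⁻¹ x)`. -/
theorem stmt19 {R : Type*} [CommRing R] [Fintype R] [IsPrincipalIdealRing R]
    {t : ℕ} (a : Fin (t + 1) → R)
    (hrep : ∀ r : R, ∃ i, Ideal.span {r} = Ideal.span {a i})
    (hinj : ∀ i j, Ideal.span {a i} = Ideal.span {a j} → i = j)
    {n : ℕ} (C : Submodule R (Fin n → R))
    (A D Q : Matrix (Fin (t + 1)) (Fin (t + 1)) ℚ)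
    (hA : ∀ i j, A i j = if Ideal.span {a i} ≤ Ideal.span {a j} then 1 else 0)
    (hD : D = Matrix.diagonal fun i => (Nat.card (Ideal.span {a i}) : ℚ))
    (hQ : ∀ i j, Q i j =
      if ∀ r ∈ Ideal.span {a j}, a i * r = 0 then 1 else 0)
    (lam : ℕ) (hlam : 0 < lam) :
    sweL a (dualCode C) lam =
      MvPolynomial.C (((Nat.card C : ℚ) ^ lam)⁻¹) *
        (MvPolynomial.bind₁ (fun i : Fin (t + 1) =>
          ∑ j : Fin (t + 1), MvPolynomial.C ((Q * D ^ lam * A⁻¹) i j) * X j))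
          (sweL a C lam) := by
  have hdet := isUnit_det_of_span_le hinj A hA
  set y : Fin (t + 1) → MvPolynomial (Fin (t + 1)) ℚ :=
    fun j => ∑ m, MvPolynomial.C (A⁻¹ j m) * X m with hy
  have hmul : ∀ (B : Matrix (Fin (t + 1)) (Fin (t + 1)) ℚ) i,
      ∑ m, MvPolynomial.C ((B * A⁻¹) i m) * X m = ∑ j, MvPolynomial.C (B i j) * y j := by
    intro B i
    simp only [hy, Matrix.mul_apply, map_sum, map_mul, Finset.sum_mul, Finset.mul_sum, mul_assoc]
    exact Finset.sum_comm
  have hX : ∀ i, (X i : MvPolynomial (Fin (t + 1)) ℚ) =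
      ∑ j, if a i ∈ Ideal.span {a j} then y j else 0 := fun i => by
    have := hmul A i
    rw [Matrix.mul_nonsing_inv _ hdet] at this
    simpa [Matrix.one_apply, hA, Ideal.span_singleton_le_iff_mem, ite_mul, apply_ite] using this
  have hQDA : ∀ i, ∑ j, MvPolynomial.C ((Q * D ^ lam * A⁻¹) i j) * X j =
      ∑ j, if a i ∈ Submodule.annihilator (Ideal.span {a j}) then
        (Nat.card (Ideal.span {a j}) : MvPolynomial (Fin (t + 1)) ℚ) ^ lam * y j else 0 :=
    fun i => by
      rw [hmul]
      refine Finset.sum_congr rfl fun j _ => ?_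
      rw [hD, Matrix.diagonal_pow, Matrix.mul_diagonal, hQ]
      simp only [Submodule.mem_annihilator, smul_eq_mul]
      split_ifs <;> simp
  have hR := isFrobeniusRing_of_isPrincipalIdealRing R
  let _ : Fintype C := Fintype.ofFinite C
  let _ : Fintype (dualCode C) := Fintype.ofFinite (dualCode C)
  simp only [sweL, map_sum, map_prod, map_pow, bind₁_X_right]
  rw [sum_prod_pow_card_span_eq hrep hinj (dualCode C) lam _ _ _ hX,
    sum_prod_pow_card_span_eq hrep hinj C lam _ _ _ hQDA, Finset.mul_sum]
  refine Finset.sum_congr rfl fun J _ => ?_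
  have hcard := hR.card_mul_card_dualCode_inf C
    (Submodule.pi Set.univ fun ℓ => Ideal.span {a (J ℓ)})
  rw [dualCode_pi, card_submodule_pi] at hcard
  have hcard' := congrArg (fun m : ℕ => (m : MvPolynomial (Fin (t + 1)) ℚ) ^ lam) hcard
  simp only [Nat.cast_mul, mul_pow, Nat.cast_prod] at hcard'
  have hC : MvPolynomial.C (((Nat.card C : ℚ) ^ lam)⁻¹) *
      (Nat.card C : MvPolynomial (Fin (t + 1)) ℚ) ^ lam = 1 := by
    have h0 : (Nat.card C : ℚ) ^ lam ≠ 0 :=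
      pow_ne_zero _ (Nat.cast_ne_zero.2 (Nat.card_pos (α := C)).ne')
    rw [← map_natCast (MvPolynomial.C : ℚ →+* MvPolynomial (Fin (t + 1)) ℚ), ← map_pow,
      ← map_mul, inv_mul_cancel₀ h0, map_one]
  rw [Finset.prod_mul_distrib, Finset.prod_pow]
  linear_combination (-(∏ ℓ, y (J ℓ)) *
      (Nat.card (dualCode C ⊓ Submodule.pi Set.univ fun ℓ => Ideal.span {a (J ℓ)} :
        Submodule R (Fin n → R)) : MvPolynomial (Fin (t + 1)) ℚ) ^ lam) * hC +
    (MvPolynomial.C (((Nat.card C : ℚ) ^ lam)⁻¹) * ∏ ℓ, y (J ℓ)) * hcard'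

end
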